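/- Let 1 < p < ∞ and let W be a matrix A_p weight on ℝ^d with reducing operators V_I. Then there exist λ₁, λ₂ > 1, with λ₁ depending only on n, d, p and λ₂ ≤ C ‖W‖_{A_p}^{p'/p} for a constant C depending only on n, d, p, such that the stopping time 𝒥 defined by letting 𝒥(I) be the maximal dyadic subcubes J of I with ‖V_J V_I^{−1}‖^p > λ₁ or ‖V_J^{−1} V_I‖^{p'} > λ₂ satisfies ∑_{J ∈ 𝒥^j(I)} |J| ≤ 2^{−j} |I| for every I ∈ 𝒟 and every j ∈ ℕ. -/

import Mathlib

open MeasureTheory ENNReal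
open scoped ComplexOrder

noncomputable section

/-! ## Basic linear-algebra notation -/

/-- The operator norm of an `n × n` complex matrix, viewed as an operator on the
Euclidean space `ℂⁿ`. -/
def matNorm {n : ℕ} (M : Matrix (Fin n) (Fin n) ℂ) : ℝ :=
  ‖Matrix.toEuclideanCLM (𝕜 := ℂ) (n := Fin n) M‖

/-- A matrix applied to a vector of `ℂⁿ` (with its Euclidean norm). -/
def mApp {n : ℕ} (M : Matrix (Fin n) (Fin n) ℂ) (v : EuclideanSpace ℂ (Fin n)) :
    EuclideanSpace ℂ (Fin n) :=
  Matrix.toEuclideanCLM (𝕜 := ℂ) (n := Fin n) M v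


/-- Entrywise measurability of a matrix-valued function. -/
def MatMeasurable {d n : ℕ} (W : (Fin d → ℝ) → Matrix (Fin n) (Fin n) ℂ) : Prop :=
  ∀ i j, Measurable fun x => W x i j

/-! ## Dyadic cubes and Haar functions -/

/-- A dyadic cube in `ℝ^d`, with side length `2^k` and lower-left corner `(m i * 2^k)_i`. -/
structure DCube (d : ℕ) where
  k : ℤ
  m : Fin d → ℤ

namespace DCube

variable {d : ℕ}

/-- The (half-open) cube in `ℝ^d` determined by a dyadic cube. -/
def set (I : DCube d) : Set (Fin d → ℝ) :=
  {x | ∀ i, (I.m i : ℝ) * 2 ^ I.k ≤ x i ∧ x i < ((I.m i : ℝ) + 1) * 2 ^ I.k}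

/-- The volume `|I| = (2^k)^d` of a dyadic cube. -/
def vol (I : DCube d) : ℝ := ((2 : ℝ) ^ I.k) ^ d

/-- The lower-left corner of a dyadic cube. -/
def corner (I : DCube d) : Fin d → ℝ := fun i => (I.m i : ℝ) * 2 ^ I.k

/-- The side length of a dyadic cube. -/
def side (I : DCube d) : ℝ := (2 : ℝ) ^ I.k

end DCube

/-- One-dimensional Haar functions on the dyadic interval `[m·2^k, (m+1)·2^k)`:
`haar1D true` is the non-cancellative `|I|^{-1/2} χ_I`, while `haar1D false` is
`|I|^{-1/2} (χ_{I_ℓ} - χ_{I_r})`. -/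
def haar1D (ε : Bool) (k mm : ℤ) (t : ℝ) : ℝ :=
  if ε then
    Set.indicator {s : ℝ | (mm : ℝ) * 2 ^ k ≤ s ∧ s < ((mm : ℝ) + 1) * 2 ^ k}
      (fun _ => ((2 : ℝ) ^ k) ^ (-(1 / 2 : ℝ))) t
  else
    Set.indicator {s : ℝ | (mm : ℝ) * 2 ^ k ≤ s ∧ s < (mm : ℝ) * 2 ^ k + 2 ^ (k - 1)}
      (fun _ => ((2 : ℝ) ^ k) ^ (-(1 / 2 : ℝ))) t -
    Set.indicator {s : ℝ | (mm : ℝ) * 2 ^ k + 2 ^ (k - 1) ≤ s ∧ s < ((mm : ℝ) + 1) * 2 ^ k}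
      (fun _ => ((2 : ℝ) ^ k) ^ (-(1 / 2 : ℝ))) t

/-- The signature set `𝒮 = {0,1}^d \ {(1,…,1)}` indexing the cancellative Haar functions. -/
def Sfin (d : ℕ) : Finset (Fin d → Bool) := Finset.univ.erase (fun _ => true)

/-- The Haar function `h_I^ε = ∏ i, h_{I_i}^{ε_i}` associated to a dyadic cube `I ⊂ ℝ^d`
and a signature `ε ∈ {0,1}^d`. -/
def haarFn {d : ℕ} (I : DCube d) (ε : Fin d → Bool) (x : Fin d → ℝ) : ℝ :=
  ∏ i, haar1D (ε i) I.k (I.m i) (x i)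

/-- The (vector of) Haar coefficients `f_I^ε = ∫ f h_I^ε` of a `ℂⁿ`-valued function. -/
def haarCoef {d n : ℕ} (f : (Fin d → ℝ) → EuclideanSpace ℂ (Fin n)) (I : DCube d)
    (ε : Fin d → Bool) : EuclideanSpace ℂ (Fin n) :=
  ∫ x, haarFn I ε x • f x

/-! ## Matrix `A_p` weights and reducing operators -/

/-- The (closed, axis-parallel) cube with corner `c` and side length `r`. -/
def cubeSet {d : ℕ} (c : Fin d → ℝ) (r : ℝ) : Set (Fin d → ℝ) :=
  {x | ∀ i, c i ≤ x i ∧ x i ≤ c i + r}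

/-- The matrix `A_p` characteristic `‖W‖_{A_p}` of a matrix weight `W`, expressed in terms of
`W1p = W^{1/p}` (so that `W^{-1/p} = (W1p)⁻¹`):
`sup_I (1/|I|) ∫_I ((1/|I|) ∫_I ‖W^{1/p}(x) W^{-1/p}(t)‖^{p'} dt)^{p/p'} dx`,
the supremum being over all cubes `I ⊂ ℝ^d`.  Here `p' = p/(p-1)` and `p/p' = p - 1`. -/
def apNorm {d n : ℕ} (p : ℝ) (W1p : (Fin d → ℝ) → Matrix (Fin n) (Fin n) ℂ) : ℝ≥0∞ :=
  ⨆ (c : Fin d → ℝ) (r : ℝ) (_ : 0 < r),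
    (ENNReal.ofReal (r ^ d))⁻¹ *
      ∫⁻ x in cubeSet c r,
        ((ENNReal.ofReal (r ^ d))⁻¹ *
            ∫⁻ t in cubeSet c r,
              ENNReal.ofReal (matNorm (W1p x * (W1p t)⁻¹)) ^ (p / (p - 1))) ^ (p - 1)

/-- The `L^q` average `(|I|^{-1} ∫_I ‖A(x) e‖^q dx)^{1/q}` over a dyadic cube. -/
def redAvgD {d n : ℕ} (q : ℝ) (A : (Fin d → ℝ) → Matrix (Fin n) (Fin n) ℂ) (I : DCube d)
    (e : EuclideanSpace ℂ (Fin n)) : ℝ≥0∞ :=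
  ((ENNReal.ofReal I.vol)⁻¹ * ∫⁻ x in I.set, ENNReal.ofReal ‖mApp (A x) e‖ ^ q) ^ (1 / q)

/-- `V` is a family of reducing operators for the weight `W = (W1p)^p` (indexed by dyadic
cubes), with comparability constants `c₁, c₂`:  each `V I` is positive definite and
`|V_I e| ≈ (|I|^{-1} ∫_I |W^{1/p}(x) e|^p dx)^{1/p}`. -/
def IsReducing {d n : ℕ} (p c₁ c₂ : ℝ) (W1p : (Fin d → ℝ) → Matrix (Fin n) (Fin n) ℂ)
    (V : DCube d → Matrix (Fin n) (Fin n) ℂ) : Prop :=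
  ∀ I : DCube d, (V I).PosDef ∧ ∀ e : EuclideanSpace ℂ (Fin n),
    ENNReal.ofReal c₁ * redAvgD p W1p I e ≤ ENNReal.ofReal ‖mApp (V I) e‖ ∧
    ENNReal.ofReal ‖mApp (V I) e‖ ≤ ENNReal.ofReal c₂ * redAvgD p W1p I e

/-- `V'` is a family of dual reducing operators for the weight `W = (W1p)^p`:
`|V_I' e| ≈ (|I|^{-1} ∫_I |W^{-1/p}(x) e|^{p'} dx)^{1/p'}` with `p' = p/(p-1)`. -/
def IsDualReducing {d n : ℕ} (p c₁ c₂ : ℝ) (W1p : (Fin d → ℝ) → Matrix (Fin n) (Fin n) ℂ)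
    (V' : DCube d → Matrix (Fin n) (Fin n) ℂ) : Prop :=
  ∀ I : DCube d, (V' I).PosDef ∧ ∀ e : EuclideanSpace ℂ (Fin n),
    ENNReal.ofReal c₁ * redAvgD (p / (p - 1)) (fun x => (W1p x)⁻¹) I e ≤
        ENNReal.ofReal ‖mApp (V' I) e‖ ∧
    ENNReal.ofReal ‖mApp (V' I) e‖ ≤
        ENNReal.ofReal c₂ * redAvgD (p / (p - 1)) (fun x => (W1p x)⁻¹) I e

/-- The `L^p(W)` norm `(∫ |W^{1/p}(x) f(x)|^p dx)^{1/p}` (as a value in `[0,∞]`). -/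
def wNorm {d n : ℕ} (p : ℝ) (W1p : (Fin d → ℝ) → Matrix (Fin n) (Fin n) ℂ)
    (f : (Fin d → ℝ) → EuclideanSpace ℂ (Fin n)) : ℝ≥0∞ :=
  (∫⁻ x, ENNReal.ofReal ‖mApp (W1p x) (f x)‖ ^ p) ^ (1 / p)

/-- The square-function expression
`∑_{I ∈ 𝒟} ∑_{ε ∈ 𝒮} |A_I f_I^ε|² |I|^{-1} χ_I(x)` for a family of matrices `A_I`. -/
def sqFn {d n : ℕ} (A : DCube d → Matrix (Fin n) (Fin n) ℂ)
    (f : (Fin d → ℝ) → EuclideanSpace ℂ (Fin n)) (x : Fin d → ℝ) : ℝ≥0∞ :=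
  ∑' I : DCube d, ∑ ε ∈ Sfin d,
    Set.indicator I.set
      (fun _ => ENNReal.ofReal (‖mApp (A I) (haarCoef f I ε)‖ ^ 2) / ENNReal.ofReal I.vol) x

/-! ## Stopping times -/

/-- A stopping time assigns to each dyadic cube `I` a collection `𝒥 I` of pairwise disjoint
dyadic subcubes of `I`. -/
def IsStopping {d : ℕ} (𝒥 : DCube d → Set (DCube d)) : Prop :=
  ∀ I : DCube d, (∀ J ∈ 𝒥 I, J.set ⊆ I.set) ∧
    (𝒥 I).Pairwise fun J K => Disjoint J.set K.set

/-- `ℱ(I)`: the dyadic subcubes of `I` not contained in any stopping cube `J ∈ 𝒥(I)`. -/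
def Fcol {d : ℕ} (𝒥 : DCube d → Set (DCube d)) (I : DCube d) : Set (DCube d) :=
  {J | J.set ⊆ I.set ∧ ∀ K ∈ 𝒥 I, ¬J.set ⊆ K.set}

/-- A stopping time is admissible if `I ∈ ℱ(I)` for every `I`. -/
def Admissible {d : ℕ} (𝒥 : DCube d → Set (DCube d)) : Prop :=
  ∀ I : DCube d, I ∈ Fcol 𝒥 I

/-- The iterated stopping collections: `𝒥^0(I) = {I}` and
`𝒥^{j+1}(I) = ⋃_{J ∈ 𝒥^j(I)} 𝒥(J)`. -/
def JIter {d : ℕ} (𝒥 : DCube d → Set (DCube d)) : ℕ → DCube d → Set (DCube d)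
  | 0, I => {I}
  | j + 1, I => ⋃ J ∈ JIter 𝒥 j I, 𝒥 J

/-- A stopping time is decaying with constant `c` if
`∑_{J ∈ 𝒥(I)} |J| ≤ c |I|` for every `I`. -/
def Decaying {d : ℕ} (c : ℝ) (𝒥 : DCube d → Set (DCube d)) : Prop :=
  ∀ I : DCube d,
    ∑' J : 𝒥 I, ENNReal.ofReal (J : DCube d).vol ≤ ENNReal.ofReal c * ENNReal.ofReal I.vol

/-- `ℱ^j = ℱ^j(I₀) = ⋃_{J ∈ 𝒥^{j-1}(I₀)} ℱ(J)` (intended for `j ≥ 1`). -/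
def Fj {d : ℕ} (𝒥 : DCube d → Set (DCube d)) (I₀ : DCube d) (j : ℕ) : Set (DCube d) :=
  ⋃ J ∈ JIter 𝒥 (j - 1) I₀, Fcol 𝒥 J

/-- The Haar projection `Δ_j f = ∑_{I ∈ ℱ^j} ∑_{ε ∈ 𝒮} f_I^ε h_I^ε`. -/
def deltaHaar {d n : ℕ} (𝒥 : DCube d → Set (DCube d)) (I₀ : DCube d) (j : ℕ)
    (f : (Fin d → ℝ) → EuclideanSpace ℂ (Fin n)) (x : Fin d → ℝ) :
    EuclideanSpace ℂ (Fin n) :=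
  ∑' I : Fj 𝒥 I₀ j, ∑ ε ∈ Sfin d, haarFn (I : DCube d) ε x • haarCoef f (I : DCube d) ε

/-! ## Constant Haar multipliers -/

/-- `∑_{I ∈ S} ∑_{ε ∈ 𝒮} V_I^{-1} f_I^ε h_I^ε(x)`. -/
def projInv {d n : ℕ} (V : DCube d → Matrix (Fin n) (Fin n) ℂ) (S : Set (DCube d))
    (f : (Fin d → ℝ) → EuclideanSpace ℂ (Fin n)) (x : Fin d → ℝ) :
    EuclideanSpace ℂ (Fin n) :=
  ∑' I : S, ∑ ε ∈ Sfin d,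
    haarFn (I : DCube d) ε x • mApp ((V (I : DCube d))⁻¹) (haarCoef f (I : DCube d) ε)

/-- A function has finite Haar expansion if it is a finite sum of Haar functions. -/
def FiniteHaar {d n : ℕ} (f : (Fin d → ℝ) → EuclideanSpace ℂ (Fin n)) : Prop :=
  ∃ F : Finset (DCube d × (Fin d → Bool)),
    ∀ x, f x = ∑ q ∈ F, haarFn q.1 q.2 x • haarCoef f q.1 q.2

/-! ## The weighted stopping time -/

/-- The stopping condition `‖V_J V_I^{-1}‖^p > λ₁` or `‖V_J^{-1} V_I‖^{p'} > λ₂`. -/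
def stopBad {d n : ℕ} (p l₁ l₂ : ℝ) (V : DCube d → Matrix (Fin n) (Fin n) ℂ)
    (J I : DCube d) : Prop :=
  l₁ < matNorm (V J * (V I)⁻¹) ^ p ∨ l₂ < matNorm ((V J)⁻¹ * V I) ^ (p / (p - 1))

/-- The stopping time `𝒥(I)` = maximal dyadic subcubes `J ⊆ I` satisfying `stopBad`. -/
def stopST {d n : ℕ} (p l₁ l₂ : ℝ) (V : DCube d → Matrix (Fin n) (Fin n) ℂ)
    (I : DCube d) : Set (DCube d) :=
  {J | J.set ⊆ I.set ∧ stopBad p l₁ l₂ V J I ∧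
    ∀ K : DCube d, K.set ⊆ I.set → stopBad p l₁ l₂ V K I → J.set ⊆ K.set → K = J}


namespace DCube
variable {d : ℕ}

theorem set_eq_pi (I : DCube d) : I.set = Set.univ.pi fun i =>
    Set.Ico ((I.m i : ℝ) * 2 ^ I.k) (((I.m i : ℝ) + 1) * 2 ^ I.k) := by
  ext x; simp [set]

theorem measurableSet_set (I : DCube d) : MeasurableSet I.set := by
  rw [set_eq_pi]
  exact MeasurableSet.univ_pi fun _ => measurableSet_Ico

theorem vol_pos (I : DCube d) : 0 < I.vol := by unfold vol; positivity

theorem volume_set (I : DCube d) : volume I.set = ENNReal.ofReal I.vol := by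
  rw [set_eq_pi, Real.volume_pi_Ico, vol, ENNReal.ofReal_pow (by positivity)]
  rw [Finset.prod_congr rfl (g := fun _ => ENNReal.ofReal (2 ^ I.k))]
  · simp
  · intro i _
    congr 1; ring

theorem set_subset_of_mem {J K : DCube d} (hk : J.k ≤ K.k) {x : Fin d → ℝ}
    (hJ : x ∈ J.set) (hK : x ∈ K.set) : J.set ⊆ K.set := by
  obtain ⟨N, hN⟩ := Int.eq_ofNat_of_zero_le (sub_nonneg.2 hk)
  have hpos : (0 : ℝ) < 2 ^ J.k := by positivity
  have hpow : (2 : ℝ) ^ K.k = ((2 ^ N : ℤ) : ℝ) * 2 ^ J.k := by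
    rw [show K.k = N + J.k by omega, zpow_add₀ (by norm_num)]
    simp
  intro y hy i
  obtain ⟨j1, j2⟩ := hJ i
  obtain ⟨k1, k2⟩ := hK i
  obtain ⟨y1, y2⟩ := hy i
  rw [hpow, ← mul_assoc] at k1 k2 ⊢
  rw [← mul_assoc]
  have a1 : ((K.m i * 2 ^ N : ℤ) : ℝ) < ((J.m i + 1 : ℤ) : ℝ) := by
    have := lt_of_mul_lt_mul_right (k1.trans_lt j2) hpos.le
    push_cast at this ⊢; exact this
  have a2 : ((J.m i : ℤ) : ℝ) < (((K.m i + 1) * 2 ^ N : ℤ) : ℝ) := by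
    have := lt_of_mul_lt_mul_right (j1.trans_lt k2) hpos.le
    push_cast at this ⊢; exact this
  have b1 := Int.lt_add_one_iff.1 (Int.cast_lt.1 a1)
  have b2 := Int.add_one_le_iff.2 (Int.cast_lt.1 a2)
  have c1 : ((K.m i * 2 ^ N : ℤ) : ℝ) ≤ J.m i := Int.cast_le.2 b1
  have c2 : ((J.m i + 1 : ℤ) : ℝ) ≤ (((K.m i + 1) * 2 ^ N : ℤ) : ℝ) := Int.cast_le.2 b2
  push_cast at c1 c2 ⊢
  exact ⟨(mul_le_mul_of_nonneg_right c1 hpos.le).trans y1,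
    y2.trans_le (mul_le_mul_of_nonneg_right c2 hpos.le)⟩

theorem disjoint_or_subset (J K : DCube d) :
    Disjoint J.set K.set ∨ J.set ⊆ K.set ∨ K.set ⊆ J.set := by
  by_cases h : Disjoint J.set K.set
  · exact Or.inl h
  · obtain ⟨x, hJ, hK⟩ := Set.not_disjoint_iff.1 h
    rcases le_total J.k K.k with hk | hk
    · exact Or.inr (Or.inl (set_subset_of_mem hk hJ hK))
    · exact Or.inr (Or.inr (set_subset_of_mem hk hK hJ))

instance : Countable (DCube d) := by
  have : Function.Injective fun I : DCube d => (I.k, I.m) := by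
    rintro ⟨k, m⟩ ⟨k', m'⟩ h
    simpa using h
  exact this.countable

theorem tsum_setLIntegral_le {S : Set (DCube d)} {I : DCube d} (hS : ∀ J ∈ S, J.set ⊆ I.set)
    (hd : S.PairwiseDisjoint DCube.set) (φ : (Fin d → ℝ) → ℝ≥0∞) :
    ∑' J : S, ∫⁻ x in (J : DCube d).set, φ x ≤ ∫⁻ x in I.set, φ x := by
  rw [← lintegral_biUnion S.to_countable (fun J _ => J.measurableSet_set) hd]
  exact lintegral_mono_set (Set.iUnion₂_subset hS)

/-- The normalized Lebesgue measure on a dyadic cube. -/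
def avgMeasure (I : DCube d) : Measure (Fin d → ℝ) :=
  (ENNReal.ofReal I.vol)⁻¹ • volume.restrict I.set

theorem ofReal_vol_ne_zero (I : DCube d) : ENNReal.ofReal I.vol ≠ 0 := by
  simpa using I.vol_pos

instance (I : DCube d) : IsProbabilityMeasure I.avgMeasure := by
  refine ⟨?_⟩
  simp only [avgMeasure, Measure.smul_apply, Measure.restrict_apply_univ, volume_set, smul_eq_mul]
  exact ENNReal.inv_mul_cancel I.ofReal_vol_ne_zero ENNReal.ofReal_ne_top

theorem lintegral_avgMeasure (I : DCube d) (φ : (Fin d → ℝ) → ℝ≥0∞) :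
    ∫⁻ x, φ x ∂I.avgMeasure = (ENNReal.ofReal I.vol)⁻¹ * ∫⁻ x in I.set, φ x := by
  rw [avgMeasure, lintegral_smul_measure, smul_eq_mul]

theorem vol_mul_lintegral_avgMeasure (I : DCube d) (φ : (Fin d → ℝ) → ℝ≥0∞) :
    ENNReal.ofReal I.vol * ∫⁻ x, φ x ∂I.avgMeasure = ∫⁻ x in I.set, φ x := by
  rw [lintegral_avgMeasure, ← mul_assoc,
    ENNReal.mul_inv_cancel I.ofReal_vol_ne_zero ENNReal.ofReal_ne_top, one_mul]

theorem avgMeasure_absolutelyContinuous (I : DCube d) : I.avgMeasure ≪ volume :=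
  (Measure.smul_absolutelyContinuous).trans Measure.restrict_le_self.absolutelyContinuous

theorem tsum_vol_mul_lintegral_avgMeasure_le {S : Set (DCube d)} {I : DCube d}
    (hS : ∀ J ∈ S, J.set ⊆ I.set) (hd : S.PairwiseDisjoint DCube.set)
    (φ : (Fin d → ℝ) → ℝ≥0∞) :
    ∑' J : S, ENNReal.ofReal (J : DCube d).vol * ∫⁻ x, φ x ∂(J : DCube d).avgMeasure ≤
      ENNReal.ofReal I.vol * ∫⁻ x, φ x ∂I.avgMeasure := by
  simp only [vol_mul_lintegral_avgMeasure]
  exact tsum_setLIntegral_le hS hd φ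

theorem set_subset_cubeSet (I : DCube d) : I.set ⊆ cubeSet I.corner I.side := by
  intro x hx i
  obtain ⟨h1, h2⟩ := hx i
  exact ⟨h1, by simp only [corner, side]; linarith⟩

end DCube

theorem stopST_pairwiseDisjoint {d n : ℕ} (p l₁ l₂ : ℝ) (V : DCube d → Matrix (Fin n) (Fin n) ℂ)
    (I : DCube d) : (stopST p l₁ l₂ V I).PairwiseDisjoint DCube.set := by
  rintro J ⟨hJ, bJ, mJ⟩ K ⟨hK, bK, mK⟩ hne
  rcases DCube.disjoint_or_subset J K with h | h | h
  · exact h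
  · exact absurd (mJ K hK bK h).symm hne
  · exact absurd (mK J hJ bJ h) hne

theorem tsum_JIter_le {d : ℕ} {𝒥 : DCube d → Set (DCube d)} {a : ℝ≥0∞}
    (h : ∀ I, ∑' J : 𝒥 I, ENNReal.ofReal (J : DCube d).vol ≤ a * ENNReal.ofReal I.vol)
    (I : DCube d) (j : ℕ) :
    ∑' J : JIter 𝒥 j I, ENNReal.ofReal (J : DCube d).vol ≤ a ^ j * ENNReal.ofReal I.vol := by
  induction j with
  | zero => simp [JIter]
  | succ j ih =>
    calc ∑' J : JIter 𝒥 (j + 1) I, ENNReal.ofReal (J : DCube d).vol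
        ≤ ∑' (J : JIter 𝒥 j I) (K : 𝒥 J), ENNReal.ofReal (K : DCube d).vol :=
          ENNReal.tsum_biUnion_le_tsum (fun J : DCube d => ENNReal.ofReal J.vol) _ _
      _ ≤ ∑' J : JIter 𝒥 j I, a * ENNReal.ofReal (J : DCube d).vol :=
          ENNReal.tsum_le_tsum fun J => h J
      _ = a * ∑' J : JIter 𝒥 j I, ENNReal.ofReal (J : DCube d).vol := ENNReal.tsum_mul_left
      _ ≤ a * (a ^ j * ENNReal.ofReal I.vol) := by gcongr
      _ = a ^ (j + 1) * ENNReal.ofReal I.vol := by ring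

theorem tsum_vol_le_of_le {d : ℕ} {S : Set (DCube d)} {G : DCube d → ℝ≥0∞} {l K v : ℝ≥0∞}
    (hl : l ≠ 0) (hl' : l ≠ ∞) (hG : ∀ J ∈ S, l ≤ G J)
    (h : ∑' J : S, ENNReal.ofReal (J : DCube d).vol * G J ≤ K * v) (hK : 4 * K ≤ l) :
    ∑' J : S, ENNReal.ofReal (J : DCube d).vol ≤ 4⁻¹ * v := by
  have h1 : l * ∑' J : S, ENNReal.ofReal (J : DCube d).vol ≤ l * (4⁻¹ * v) := by
    calc l * ∑' J : S, ENNReal.ofReal (J : DCube d).vol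
        = ∑' J : S, ENNReal.ofReal (J : DCube d).vol * l := by
          rw [← ENNReal.tsum_mul_left]; simp only [mul_comm]
      _ ≤ ∑' J : S, ENNReal.ofReal (J : DCube d).vol * G J :=
          ENNReal.tsum_le_tsum fun J => by gcongr; exact hG J J.2
      _ ≤ K * v := h
      _ = 4 * K * (4⁻¹ * v) := by
          rw [show 4 * K * (4⁻¹ * v) = (4 * 4⁻¹) * (K * v) by ring,
            ENNReal.mul_inv_cancel (by norm_num) (by norm_num), one_mul]
      _ ≤ l * (4⁻¹ * v) := by gcongr
  exact (ENNReal.mul_le_mul_iff_right hl hl').1 h1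

theorem aestronglyMeasurable_clm_apply {X E F : Type*} [MeasurableSpace X] {ν : Measure X}
    [NormedAddCommGroup E] [NormedSpace ℂ E] [NormedAddCommGroup F] [NormedSpace ℂ F]
    {B : X → E →L[ℂ] F} {g : X → E} (hB : AEStronglyMeasurable B ν)
    (hg : AEStronglyMeasurable g ν) : AEStronglyMeasurable (fun x => B x (g x)) ν :=
  (isBoundedBilinearMap_apply (𝕜 := ℂ) (E := E) (F := F)).continuous.comp_aestronglyMeasurable
    (hB.prodMk hg)

theorem enorm_inner_le {E : Type*} [NormedAddCommGroup E] [InnerProductSpace ℂ E] (x y : E) :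
    ‖inner ℂ x y‖ₑ ≤ ‖x‖ₑ * ‖y‖ₑ := by
  simp only [enorm]
  exact_mod_cast nnnorm_inner_le_nnnorm (𝕜 := ℂ) x y

theorem enorm_reducing_inv_le {X E : Type*} [MeasurableSpace X] {ν : Measure X}
    [IsProbabilityMeasure ν] [NormedAddCommGroup E] [InnerProductSpace ℂ E]
    {p q : ℝ} (hpq : p.HolderConjugate q) {A B : X → E →L[ℂ] E} {V U : E →L[ℂ] E}
    (hA : AEStronglyMeasurable A ν) (hB : AEStronglyMeasurable B ν)
    (hAB : ∀ᵐ x ∂ν, ∀ v w, inner ℂ (B x v) (A x w) = inner ℂ v w)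
    (hU : ∀ v w, inner ℂ (U v) w = inner ℂ v (U w)) (hVU : ∀ v, V (U v) = v) {c : ℝ≥0∞}
    (hV : ∀ v, c * (∫⁻ x, ‖A x v‖ₑ ^ p ∂ν) ^ (1 / p) ≤ ‖V v‖ₑ) (e : E) :
    c * ‖U e‖ₑ ≤ (∫⁻ x, ‖B x e‖ₑ ^ q ∂ν) ^ (1 / q) := by
  set R := (∫⁻ x, ‖B x e‖ₑ ^ q ∂ν) ^ (1 / q)
  by_cases h0 : ‖U e‖ₑ = 0
  · simp [h0]
  have h1 : ‖U e‖ₑ * ‖U e‖ₑ ≤ R * (∫⁻ x, ‖A x (U (U e))‖ₑ ^ p ∂ν) ^ (1 / p) := by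
    calc ‖U e‖ₑ * ‖U e‖ₑ = ‖inner ℂ e (U (U e))‖ₑ := by
          rw [← hU, inner_self_eq_norm_sq_to_K, ← enorm_norm (U e), ← enorm_mul]
          rw [← sq, ← enorm_norm (_ : ℂ)]
          simp
      _ = ∫⁻ _, ‖inner ℂ e (U (U e))‖ₑ ∂ν := by simp
      _ ≤ ∫⁻ x, ((fun x => ‖B x e‖ₑ) * (fun x => ‖A x (U (U e))‖ₑ)) x ∂ν := by
          refine lintegral_mono_ae ?_
          filter_upwards [hAB] with x hx
          rw [← hx]
          exact enorm_inner_le _ _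
      _ ≤ _ := ENNReal.lintegral_mul_le_Lp_mul_Lq ν hpq.symm
          (aestronglyMeasurable_clm_apply hB aestronglyMeasurable_const).enorm
          (aestronglyMeasurable_clm_apply hA aestronglyMeasurable_const).enorm
  have h2 : c * ‖U e‖ₑ * ‖U e‖ₑ ≤ R * ‖U e‖ₑ := by
    calc c * ‖U e‖ₑ * ‖U e‖ₑ = c * (‖U e‖ₑ * ‖U e‖ₑ) := by ring
      _ ≤ c * (R * (∫⁻ x, ‖A x (U (U e))‖ₑ ^ p ∂ν) ^ (1 / p)) := by gcongr
      _ = R * (c * (∫⁻ x, ‖A x (U (U e))‖ₑ ^ p ∂ν) ^ (1 / p)) := by ring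
      _ ≤ R * ‖V (U (U e))‖ₑ := by gcongr; exact hV _
      _ = R * ‖U e‖ₑ := by rw [hVU]
  exact (ENNReal.mul_le_mul_iff_left h0 enorm_ne_top).1 h2

theorem lintegral_enorm_inv_apply_reducing_le {X E : Type*} [MeasurableSpace X] {ν : Measure X}
    [IsFiniteMeasure ν] [NormedAddCommGroup E] [InnerProductSpace ℂ E] [CompleteSpace E]
    {p q : ℝ} (hpq : p.HolderConjugate q) {A B : X → E →L[ℂ] E} {V : E →L[ℂ] E}
    (hB : AEStronglyMeasurable B ν)
    (hBs : ∀ᵐ x ∂ν, ∀ v w, inner ℂ (B x v) w = inner ℂ v (B x w))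
    (hBfin : ∫⁻ t, ‖B t‖ₑ ^ q ∂ν ≠ ∞)
    (hVs : ∀ v w, inner ℂ (V v) w = inner ℂ v (V w)) {c : ℝ≥0∞}
    (hV : ∀ v, ‖V v‖ₑ ≤ c * (∫⁻ x, ‖A x v‖ₑ ^ p ∂ν) ^ (1 / p)) (e : E) :
    ∫⁻ t, ‖B t (V e)‖ₑ ^ q ∂ν ≤
      (c * ‖e‖ₑ) ^ q * (∫⁻ x, (∫⁻ t, ‖A x * B t‖ₑ ^ q ∂ν) ^ (p - 1) ∂ν) ^ (1 / (p - 1)) := by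
  have hp0 := hpq.pos
  have hq0 := hpq.symm.pos
  have hp1 : 0 < p - 1 := hpq.sub_one_pos
  have hq1 : 0 < q - 1 := hpq.symm.sub_one_pos
  have hqp : (q - 1) * p = q := by have := hpq.symm.sub_one_mul_conj; exact this
  set f : X → E := fun t => B t (V e)
  set g : X → E := fun t => ((‖f t‖ ^ (q - 2) : ℝ) : ℂ) • f t
  set R := ∫⁻ t, ‖f t‖ₑ ^ q ∂ν
  set N := ∫⁻ x, (∫⁻ t, ‖A x * B t‖ₑ ^ q ∂ν) ^ (p - 1) ∂ν
  have hf : AEStronglyMeasurable f ν := aestronglyMeasurable_clm_apply hB aestronglyMeasurable_const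
  have hg : AEStronglyMeasurable g ν :=
    (Complex.measurable_ofReal.comp_aemeasurable
      (hf.norm.aemeasurable.pow_const (q - 2))).aestronglyMeasurable.smul hf
  have hgn : ∀ t, ‖g t‖ = ‖f t‖ ^ (q - 1) := by
    intro t
    by_cases h0 : ‖f t‖ = 0
    · have : f t = 0 := norm_eq_zero.1 h0
      simp [g, this, Real.zero_rpow hq1.ne']
    · have : 0 < ‖f t‖ := lt_of_le_of_ne (norm_nonneg _) (Ne.symm h0)
      simp only [g, norm_smul, Complex.norm_real, Real.norm_eq_abs]
      rw [abs_of_nonneg (by positivity)]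
      nth_rw 2 [← Real.rpow_one ‖f t‖]
      rw [← Real.rpow_add this]
      ring_nf
  have hge : ∀ t, ‖g t‖ₑ = ‖f t‖ₑ ^ (q - 1) := by
    intro t
    rw [← ofReal_norm, hgn, ← ENNReal.ofReal_rpow_of_nonneg (norm_nonneg _) hq1.le, ofReal_norm]
  have hfg : ∀ t, inner ℂ (f t) (g t) = ((‖f t‖ ^ q : ℝ) : ℂ) := by
    intro t
    have h : ‖f t‖ ^ (q - 2) * ‖f t‖ ^ 2 = ‖f t‖ ^ q := by
      by_cases h0 : ‖f t‖ = 0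
      · simp [h0, Real.zero_rpow hq0.ne']
      · have : 0 < ‖f t‖ := lt_of_le_of_ne (norm_nonneg _) (Ne.symm h0)
        rw [← Real.rpow_natCast, ← Real.rpow_add this]
        simp
    simp only [g, inner_smul_right, inner_self_eq_norm_sq_to_K]
    rw [← h]
    push_cast
    rfl
  have hRfin : R ≠ ∞ := by
    refine ne_top_of_le_ne_top (ENNReal.mul_ne_top hBfin
      (ENNReal.rpow_ne_top_of_nonneg hq0.le (enorm_ne_top (x := V e)))) ?_
    rw [← lintegral_mul_const' _ _ (ENNReal.rpow_ne_top_of_nonneg hq0.le enorm_ne_top)]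
    refine lintegral_mono fun t => ?_
    rw [← ENNReal.mul_rpow_of_nonneg _ _ hq0.le]
    exact ENNReal.rpow_le_rpow ((B t).le_opENorm _) hq0.le
  have hBg : Integrable (fun t => B t (g t)) ν := by
    refine ⟨aestronglyMeasurable_clm_apply hB hg, ?_⟩
    refine lt_of_le_of_lt ?_ (ENNReal.mul_lt_top hBfin.lt_top
      (ENNReal.rpow_lt_top_of_nonneg hq1.le (enorm_ne_top (x := V e))))
    rw [← lintegral_mul_const' _ _ (ENNReal.rpow_ne_top_of_nonneg hq1.le enorm_ne_top)]
    refine lintegral_mono fun t => ?_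
    calc ‖B t (g t)‖ₑ ≤ ‖B t‖ₑ * ‖f t‖ₑ ^ (q - 1) := by
          rw [← hge]; exact (B t).le_opENorm _
      _ ≤ ‖B t‖ₑ * (‖B t‖ₑ * ‖V e‖ₑ) ^ (q - 1) := by
          gcongr
          exact (B t).le_opENorm _
      _ = ‖B t‖ₑ ^ q * ‖V e‖ₑ ^ (q - 1) := by
          rw [ENNReal.mul_rpow_of_nonneg _ _ hq1.le, ← mul_assoc]
          congr 1
          nth_rw 1 [← ENNReal.rpow_one ‖B t‖ₑ]
          rw [← ENNReal.rpow_add_of_nonneg _ _ zero_le_one hq1.le]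
          ring_nf
  set u : E := ∫ t, B t (g t) ∂ν
  have hint : inner ℂ (V e) u = ((∫ t, ‖f t‖ ^ q ∂ν : ℝ) : ℂ) := by
    rw [← integral_inner hBg, ← integral_complex_ofReal]
    refine integral_congr_ae ?_
    filter_upwards [hBs] with t ht
    rw [← ht, ← hfg]
  have hRf : ENNReal.ofReal (∫ t, ‖f t‖ ^ q ∂ν) = R := by
    have hpt : ∀ t, ENNReal.ofReal (‖f t‖ ^ q) = ‖f t‖ₑ ^ q := fun t => by
      rw [← ENNReal.ofReal_rpow_of_nonneg (norm_nonneg _) hq0.le, ofReal_norm]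
    rw [ofReal_integral_eq_lintegral_ofReal]
    · simp only [hpt]; rfl
    · refine ⟨(hf.norm.aemeasurable.pow_const q).aestronglyMeasurable, ?_⟩
      unfold HasFiniteIntegral
      refine lt_of_le_of_lt (le_of_eq ?_) hRfin.lt_top
      refine lintegral_congr fun t => ?_
      rw [Real.enorm_eq_ofReal (by positivity), hpt]
    · exact Filter.Eventually.of_forall fun t => by positivity
  have hAu : ∀ x, ‖A x u‖ₑ ^ p ≤ (∫⁻ t, ‖A x * B t‖ₑ ^ q ∂ν) ^ (p - 1) * R := by
    intro x
    have hAB : AEStronglyMeasurable (fun t => A x * B t) ν :=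
      (continuous_const.mul continuous_id).comp_aestronglyMeasurable hB
    have h1 : ‖A x u‖ₑ ≤ (∫⁻ t, ‖A x * B t‖ₑ ^ q ∂ν) ^ (1 / q) * R ^ (1 / p) := by
      calc ‖A x u‖ₑ = ‖∫ t, A x (B t (g t)) ∂ν‖ₑ := by
            rw [(A x).integral_comp_comm hBg]
        _ ≤ ∫⁻ t, ‖A x (B t (g t))‖ₑ ∂ν := enorm_integral_le_lintegral_enorm _
        _ ≤ ∫⁻ t, ((fun t => ‖A x * B t‖ₑ) * (fun t => ‖g t‖ₑ)) t ∂ν :=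
            lintegral_mono fun t => (A x * B t).le_opENorm (g t)
        _ ≤ (∫⁻ t, ‖A x * B t‖ₑ ^ q ∂ν) ^ (1 / q) * (∫⁻ t, ‖g t‖ₑ ^ p ∂ν) ^ (1 / p) :=
            ENNReal.lintegral_mul_le_Lp_mul_Lq ν hpq.symm hAB.enorm hg.enorm
        _ = _ := by
            simp only [hge, ← ENNReal.rpow_mul, hqp]; rfl
    calc ‖A x u‖ₑ ^ p ≤ ((∫⁻ t, ‖A x * B t‖ₑ ^ q ∂ν) ^ (1 / q) * R ^ (1 / p)) ^ p := by gcongr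
      _ = _ := by
        rw [ENNReal.mul_rpow_of_nonneg _ _ hp0.le, ← ENNReal.rpow_mul, ← ENNReal.rpow_mul]
        congr 2
        · rw [one_div, ← hpq.one_sub_inv]; field_simp
        · rw [one_div, inv_mul_cancel₀ hp0.ne', ENNReal.rpow_one]
  have hmain : R ≤ ‖e‖ₑ * (c * (N * R) ^ (1 / p)) := by
    calc R = ‖inner ℂ (V e) u‖ₑ := by
          rw [hint, ← hRf, ← ofReal_norm, Complex.norm_real, Real.norm_of_nonneg]
          exact integral_nonneg fun t => by positivity
      _ ≤ ‖e‖ₑ * ‖V u‖ₑ := by rw [hVs]; exact enorm_inner_le _ _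
      _ ≤ ‖e‖ₑ * (c * (∫⁻ x, ‖A x u‖ₑ ^ p ∂ν) ^ (1 / p)) := by gcongr; exact hV u
      _ ≤ _ := by
          gcongr
          rw [← lintegral_mul_const' _ _ hRfin]
          exact lintegral_mono hAu
  by_cases hR0 : R = 0
  · rw [hR0]; exact zero_le
  have hRp : R ^ (1 / p) ≠ 0 := by simp [ENNReal.rpow_eq_zero_iff, hR0, hRfin]
  have hRp' : R ^ (1 / p) ≠ ∞ := ENNReal.rpow_ne_top_of_nonneg (by positivity) hRfin
  have h3 : R ^ (1 / q) * R ^ (1 / p) ≤ (c * ‖e‖ₑ * N ^ (1 / p)) * R ^ (1 / p) := by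
    rw [← ENNReal.rpow_add_of_nonneg _ _ (by positivity) (by positivity), one_div, one_div,
      hpq.symm.inv_add_inv_eq_one, ENNReal.rpow_one]
    refine hmain.trans (le_of_eq ?_)
    rw [ENNReal.mul_rpow_of_nonneg _ _ (by positivity), one_div]
    ring
  have h4 := (ENNReal.mul_le_mul_iff_left hRp hRp').1 h3
  have h5 := ENNReal.rpow_le_rpow h4 hq0.le
  rw [← ENNReal.rpow_mul, one_div, inv_mul_cancel₀ hq0.ne', ENNReal.rpow_one,
    ENNReal.mul_rpow_of_nonneg _ _ hq0.le, ← ENNReal.rpow_mul] at h5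
  refine h5.trans (le_of_eq ?_)
  congr 2
  rw [hpq.conjugate_eq]
  field_simp

theorem enorm_toEuclideanCLM {n : ℕ} (M : Matrix (Fin n) (Fin n) ℂ) :
    ‖Matrix.toEuclideanCLM (𝕜 := ℂ) (n := Fin n) M‖ₑ = ENNReal.ofReal (matNorm M) := by
  rw [matNorm, ofReal_norm]

theorem enorm_clm_le_sum {n : ℕ} (M : EuclideanSpace ℂ (Fin n) →L[ℂ] EuclideanSpace ℂ (Fin n)) :
    ‖M‖ₑ ≤ ∑ i, ‖M (EuclideanSpace.single i 1)‖ₑ := by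
  have h : ‖M‖ ≤ ∑ i, ‖M (EuclideanSpace.single i 1)‖ := by
    refine M.opNorm_le_bound (by positivity) fun v => ?_
    have hv : v = ∑ i, v i • EuclideanSpace.single i (1 : ℂ) := by
      ext j; simp [Finset.sum_apply, Pi.single_apply]
    calc ‖M v‖ = ‖∑ i, v i • M (EuclideanSpace.single i 1)‖ := by
          conv_lhs => rw [hv]
          simp only [map_sum, map_smul]
      _ ≤ ∑ i, ‖v i • M (EuclideanSpace.single i 1)‖ := norm_sum_le _ _
      _ ≤ ∑ i, ‖v‖ * ‖M (EuclideanSpace.single i 1)‖ := by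
          refine Finset.sum_le_sum fun i _ => ?_
          rw [norm_smul]
          gcongr
          exact PiLp.norm_apply_le v i
      _ = _ := by rw [← Finset.mul_sum, mul_comm]
  rw [← ofReal_norm]
  refine (ENNReal.ofReal_le_ofReal h).trans (le_of_eq ?_)
  rw [ENNReal.ofReal_sum_of_nonneg fun _ _ => norm_nonneg _]
  simp only [ofReal_norm]

theorem enorm_clm_rpow_le_sum {n : ℕ} {r : ℝ} (hr : 1 ≤ r)
    (M : EuclideanSpace ℂ (Fin n) →L[ℂ] EuclideanSpace ℂ (Fin n)) :
    ‖M‖ₑ ^ r ≤ (n : ℝ≥0∞) ^ (r - 1) * ∑ i, ‖M (EuclideanSpace.single i 1)‖ₑ ^ r := by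
  refine (ENNReal.rpow_le_rpow (enorm_clm_le_sum M) (by linarith)).trans ?_
  simpa using ENNReal.rpow_sum_le_const_mul_sum_rpow Finset.univ
    (fun i => ‖M (EuclideanSpace.single i 1)‖ₑ) hr

theorem tsum_vol_mul_enorm_rpow_le {d n : ℕ} {r : ℝ} (hr : 1 ≤ r) {S : Set (DCube d)} {I : DCube d}
    (hS : ∀ J ∈ S, J.set ⊆ I.set) (hd : S.PairwiseDisjoint DCube.set)
    {M : DCube d → EuclideanSpace ℂ (Fin n) →L[ℂ] EuclideanSpace ℂ (Fin n)}
    {φ : Fin n → (Fin d → ℝ) → ℝ≥0∞} {κ κ' : ℝ≥0∞}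
    (hM : ∀ J i, ‖M J (EuclideanSpace.single i 1)‖ₑ ^ r ≤ κ * ∫⁻ x, φ i x ∂J.avgMeasure)
    (hI : ∀ i, ∫⁻ x, φ i x ∂I.avgMeasure ≤ κ') :
    ∑' J : S, ENNReal.ofReal (J : DCube d).vol * ‖M J‖ₑ ^ r ≤
      (n : ℝ≥0∞) ^ (r - 1) * κ * (n * κ') * ENNReal.ofReal I.vol := by
  calc ∑' J : S, ENNReal.ofReal (J : DCube d).vol * ‖M J‖ₑ ^ r
      ≤ ∑' J : S, (n : ℝ≥0∞) ^ (r - 1) * κ * ∑ i,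
          ENNReal.ofReal (J : DCube d).vol * ∫⁻ x, φ i x ∂(J : DCube d).avgMeasure := by
        refine ENNReal.tsum_le_tsum fun J => ?_
        calc ENNReal.ofReal (J : DCube d).vol * ‖M J‖ₑ ^ r
            ≤ ENNReal.ofReal (J : DCube d).vol * ((n : ℝ≥0∞) ^ (r - 1) *
                ∑ i, κ * ∫⁻ x, φ i x ∂(J : DCube d).avgMeasure) := by
              gcongr
              refine (enorm_clm_rpow_le_sum hr _).trans ?_
              gcongr with i
              exact hM J i
          _ = _ := by
              rw [← Finset.mul_sum, ← Finset.mul_sum]; ring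
    _ = (n : ℝ≥0∞) ^ (r - 1) * κ * ∑ i, ∑' J : S,
          ENNReal.ofReal (J : DCube d).vol * ∫⁻ x, φ i x ∂(J : DCube d).avgMeasure := by
        rw [ENNReal.tsum_mul_left, Summable.tsum_finsetSum fun _ _ => ENNReal.summable]
    _ ≤ (n : ℝ≥0∞) ^ (r - 1) * κ * ∑ _i : Fin n, ENNReal.ofReal I.vol * κ' := by
        gcongr with i
        refine (DCube.tsum_vol_mul_lintegral_avgMeasure_le hS hd (φ i)).trans ?_
        gcongr
        exact hI i
    _ = _ := by simp; ring

theorem Matrix.PosDef.inner_toEuclideanCLM {n : ℕ} {M : Matrix (Fin n) (Fin n) ℂ} (h : M.PosDef)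
    (v w : EuclideanSpace ℂ (Fin n)) :
    inner ℂ (Matrix.toEuclideanCLM (𝕜 := ℂ) (n := Fin n) M v) w =
      inner ℂ v (Matrix.toEuclideanCLM (𝕜 := ℂ) (n := Fin n) M w) := by
  have hs : IsSelfAdjoint (Matrix.toEuclideanCLM (𝕜 := ℂ) (n := Fin n) M) := by
    unfold IsSelfAdjoint
    rw [← map_star]
    congr 1
    exact h.isHermitian
  exact hs.isSymmetric v w

theorem Matrix.PosDef.toEuclideanCLM_apply_inv {n : ℕ} {M : Matrix (Fin n) (Fin n) ℂ}
    (h : M.PosDef) (v : EuclideanSpace ℂ (Fin n)) :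
    Matrix.toEuclideanCLM (𝕜 := ℂ) (n := Fin n) M
      (Matrix.toEuclideanCLM (𝕜 := ℂ) (n := Fin n) M⁻¹ v) = v := by
  rw [← mul_apply_eq_comp, ← map_mul,
    Matrix.mul_nonsing_inv _ ((Matrix.isUnit_iff_isUnit_det _).1 h.isUnit), map_one]
  rfl

theorem MatMeasurable.inv {d n : ℕ} {W : (Fin d → ℝ) → Matrix (Fin n) (Fin n) ℂ}
    (hW : MatMeasurable W) : MatMeasurable fun x => (W x)⁻¹ := by
  have hdet : ∀ M : (Fin d → ℝ) → Matrix (Fin n) (Fin n) ℂ, MatMeasurable M →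
      Measurable fun x => (M x).det := by
    intro M hM
    simp only [Matrix.det_apply]
    refine Finset.measurable_sum _ fun σ _ => ?_
    exact (Finset.measurable_prod _ fun i _ => hM _ _).const_smul _
  intro i j
  simp only [Matrix.inv_def, Matrix.smul_apply, Ring.inverse_eq_inv', smul_eq_mul,
    Matrix.adjugate_apply]
  refine (hdet W hW).inv.mul (hdet _ fun k l => ?_)
  by_cases hk : k = j
  · subst hk; simp
  · simpa [Matrix.updateRow_ne hk] using hW k l

theorem MatMeasurable.stronglyMeasurable_toEuclideanCLM {d n : ℕ}
    {W : (Fin d → ℝ) → Matrix (Fin n) (Fin n) ℂ} (hW : MatMeasurable W) :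
    StronglyMeasurable fun x => Matrix.toEuclideanCLM (𝕜 := ℂ) (n := Fin n) (W x) := by
  have h : ∀ x, Matrix.toEuclideanCLM (𝕜 := ℂ) (n := Fin n) (W x) =
      ∑ i, ∑ j, W x i j • Matrix.toEuclideanCLM (𝕜 := ℂ) (n := Fin n) (Matrix.single i j 1) := by
    intro x
    conv_lhs => rw [Matrix.matrix_eq_sum_single (W x)]
    simp only [map_sum, ← map_smul, Matrix.smul_single, smul_eq_mul, mul_one]
  simp only [h]
  refine Finset.stronglyMeasurable_fun_sum _ fun i _ => Finset.stronglyMeasurable_fun_sum _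
    fun j _ => (hW i j).stronglyMeasurable.smul_const _

theorem lintegral_avgMeasure_le_apNorm {d n : ℕ} {p : ℝ} (hp : 1 < p)
    (W : (Fin d → ℝ) → Matrix (Fin n) (Fin n) ℂ) (I : DCube d) :
    ∫⁻ x, (∫⁻ t, ‖Matrix.toEuclideanCLM (𝕜 := ℂ) (n := Fin n) (W x) *
        Matrix.toEuclideanCLM (𝕜 := ℂ) (n := Fin n) (W t)⁻¹‖ₑ ^ (p / (p - 1))
          ∂I.avgMeasure) ^ (p - 1) ∂I.avgMeasure ≤ apNorm p W := by
  have hside : 0 < I.side := by unfold DCube.side; positivity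
  refine le_trans ?_ (le_iSup_of_le I.corner (le_iSup_of_le I.side (le_iSup_of_le hside le_rfl)))
  have hvol : I.side ^ d = I.vol := rfl
  simp only [DCube.lintegral_avgMeasure, hvol, ← map_mul, enorm_toEuclideanCLM]
  have : 0 ≤ p - 1 := by linarith
  gcongr <;> exact I.set_subset_cubeSet

theorem lintegral_enorm_inv_ne_top {d n : ℕ} {p : ℝ} (hp : 1 < p)
    {W : (Fin d → ℝ) → Matrix (Fin n) (Fin n) ℂ}
    (hpos : ∀ᵐ x ∂(volume : Measure (Fin d → ℝ)), (W x).PosDef) (hap : apNorm p W < ⊤)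
    (I : DCube d) :
    ∫⁻ t, ‖Matrix.toEuclideanCLM (𝕜 := ℂ) (n := Fin n) (W t)⁻¹‖ₑ ^ (p / (p - 1))
      ∂I.avgMeasure ≠ ∞ := by
  have hq : 0 ≤ p / (p - 1) := div_nonneg (by linarith) (by linarith)
  intro htop
  have hpos' := I.avgMeasure_absolutelyContinuous.ae_le hpos
  refine (lt_of_le_of_lt (lintegral_avgMeasure_le_apNorm hp W I) hap).ne ?_
  rw [lintegral_congr_ae (g := fun _ => ∞)]
  · simp
  filter_upwards [hpos'] with x hx
  set T := Matrix.toEuclideanCLM (𝕜 := ℂ) (n := Fin n)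
  have hle : ∫⁻ t, ‖T (W t)⁻¹‖ₑ ^ (p / (p - 1)) ∂I.avgMeasure ≤
      ‖T (W x)⁻¹‖ₑ ^ (p / (p - 1)) *
        ∫⁻ t, ‖T (W x) * T (W t)⁻¹‖ₑ ^ (p / (p - 1)) ∂I.avgMeasure := by
    rw [← lintegral_const_mul' _ _ (ENNReal.rpow_ne_top_of_nonneg hq enorm_ne_top)]
    refine lintegral_mono fun t => ?_
    rw [← ENNReal.mul_rpow_of_nonneg _ _ hq]
    refine ENNReal.rpow_le_rpow ?_ hq
    have : T (W t)⁻¹ = T (W x)⁻¹ * (T (W x) * T (W t)⁻¹) := by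
      rw [← mul_assoc, ← map_mul T (W x)⁻¹,
        Matrix.nonsing_inv_mul _ ((Matrix.isUnit_iff_isUnit_det _).1 hx.isUnit), map_one, one_mul]
    conv_lhs => rw [this]
    simp only [enorm]
    exact_mod_cast nnnorm_mul_le _ _
  rw [htop, top_le_iff] at hle
  have h2 : ∫⁻ t, ‖T (W x) * T (W t)⁻¹‖ₑ ^ (p / (p - 1)) ∂I.avgMeasure = ∞ := by
    by_contra h
    exact ENNReal.mul_ne_top (ENNReal.rpow_ne_top_of_nonneg hq enorm_ne_top) h hle
  change (∫⁻ t, ‖T (W x) * T (W t)⁻¹‖ₑ ^ (p / (p - 1)) ∂I.avgMeasure) ^ (p - 1) = ∞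
  rw [h2, ENNReal.top_rpow_of_pos (by linarith)]

theorem redAvgD_eq {d n : ℕ} (q : ℝ) (A : (Fin d → ℝ) → Matrix (Fin n) (Fin n) ℂ) (I : DCube d)
    (e : EuclideanSpace ℂ (Fin n)) : redAvgD q A I e =
      (∫⁻ x, ‖Matrix.toEuclideanCLM (𝕜 := ℂ) (n := Fin n) (A x) e‖ₑ ^ q ∂I.avgMeasure)
        ^ (1 / q) := by
  simp only [redAvgD, DCube.lintegral_avgMeasure, mApp, ofReal_norm]

theorem IsReducing.enorm_rpow_le {d n : ℕ} {p c₁ c₂ : ℝ} (hp : 0 < p)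
    {W : (Fin d → ℝ) → Matrix (Fin n) (Fin n) ℂ} {V : DCube d → Matrix (Fin n) (Fin n) ℂ}
    (hV : IsReducing p c₁ c₂ W V) (I : DCube d) (v : EuclideanSpace ℂ (Fin n)) :
    ‖Matrix.toEuclideanCLM (𝕜 := ℂ) (n := Fin n) (V I) v‖ₑ ^ p ≤ ENNReal.ofReal c₂ ^ p *
      ∫⁻ x, ‖Matrix.toEuclideanCLM (𝕜 := ℂ) (n := Fin n) (W x) v‖ₑ ^ p ∂I.avgMeasure := by
  have h := ((hV I).2 v).2
  rw [redAvgD_eq, mApp, ofReal_norm] at h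
  refine (ENNReal.rpow_le_rpow h hp.le).trans (le_of_eq ?_)
  rw [ENNReal.mul_rpow_of_nonneg _ _ hp.le, ← ENNReal.rpow_mul, one_div_mul_cancel hp.ne',
    ENNReal.rpow_one]

theorem IsReducing.lintegral_le {d n : ℕ} {p c₁ c₂ : ℝ} (hp : 0 < p) (hc₁ : 0 < c₁)
    {W : (Fin d → ℝ) → Matrix (Fin n) (Fin n) ℂ} {V : DCube d → Matrix (Fin n) (Fin n) ℂ}
    (hV : IsReducing p c₁ c₂ W V) (I : DCube d) (v : EuclideanSpace ℂ (Fin n)) :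
    ∫⁻ x, ‖Matrix.toEuclideanCLM (𝕜 := ℂ) (n := Fin n) (W x) v‖ₑ ^ p ∂I.avgMeasure ≤
      (ENNReal.ofReal c₁)⁻¹ ^ p *
        ‖Matrix.toEuclideanCLM (𝕜 := ℂ) (n := Fin n) (V I) v‖ₑ ^ p := by
  have h := ((hV I).2 v).1
  have hc : ENNReal.ofReal c₁ ≠ 0 := by simpa using hc₁
  rw [redAvgD_eq, mApp, ofReal_norm] at h
  rw [← ENNReal.mul_rpow_of_nonneg _ _ hp.le]
  have h2 : (∫⁻ x, ‖Matrix.toEuclideanCLM (𝕜 := ℂ) (n := Fin n) (W x) v‖ₑ ^ p ∂I.avgMeasure)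
      ^ (1 / p) ≤ (ENNReal.ofReal c₁)⁻¹ *
        ‖Matrix.toEuclideanCLM (𝕜 := ℂ) (n := Fin n) (V I) v‖ₑ := by
    calc _ = (ENNReal.ofReal c₁)⁻¹ * (ENNReal.ofReal c₁ * (∫⁻ x,
          ‖Matrix.toEuclideanCLM (𝕜 := ℂ) (n := Fin n) (W x) v‖ₑ ^ p ∂I.avgMeasure) ^ (1 / p)) := by
          rw [← mul_assoc, ENNReal.inv_mul_cancel hc ENNReal.ofReal_ne_top, one_mul]
      _ ≤ _ := by gcongr
  refine le_trans (le_of_eq ?_) (ENNReal.rpow_le_rpow h2 hp.le)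
  rw [← ENNReal.rpow_mul, one_div_mul_cancel hp.ne', ENNReal.rpow_one]

theorem tsum_vol_mul_reducing_rpow_le {d n : ℕ} {p c₁ c₂ : ℝ} (hp : 1 < p) (hc₁ : 0 < c₁)
    {W : (Fin d → ℝ) → Matrix (Fin n) (Fin n) ℂ} {V : DCube d → Matrix (Fin n) (Fin n) ℂ}
    (hV : IsReducing p c₁ c₂ W V) {S : Set (DCube d)} {I : DCube d}
    (hS : ∀ J ∈ S, J.set ⊆ I.set) (hd : S.PairwiseDisjoint DCube.set) :
    ∑' J : S, ENNReal.ofReal (J : DCube d).vol * ENNReal.ofReal (matNorm (V J * (V I)⁻¹)) ^ p ≤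
      (n : ℝ≥0∞) ^ (p - 1) * ENNReal.ofReal c₂ ^ p * (n * (ENNReal.ofReal c₁)⁻¹ ^ p) *
        ENNReal.ofReal I.vol := by
  have hp0 : 0 < p := by linarith
  simp only [← enorm_toEuclideanCLM]
  refine tsum_vol_mul_enorm_rpow_le hp.le hS hd
    (M := fun J => Matrix.toEuclideanCLM (𝕜 := ℂ) (n := Fin n) (V J * (V I)⁻¹))
    (φ := fun i x => ‖Matrix.toEuclideanCLM (𝕜 := ℂ) (n := Fin n) (W x)
      (Matrix.toEuclideanCLM (𝕜 := ℂ) (n := Fin n) (V I)⁻¹ (EuclideanSpace.single i 1))‖ₑ ^ p)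
    (fun J i => ?_) fun i => ?_
  · rw [map_mul, mul_apply_eq_comp]
    exact hV.enorm_rpow_le hp0 J _
  · refine (hV.lintegral_le hp0 hc₁ I _).trans ?_
    rw [(hV I).1.toEuclideanCLM_apply_inv]
    simp [← ofReal_norm]

theorem tsum_vol_mul_inv_reducing_rpow_le {d n : ℕ} {p c₁ c₂ : ℝ} (hp : 1 < p) (hc₁ : 0 < c₁)
    {W : (Fin d → ℝ) → Matrix (Fin n) (Fin n) ℂ} {V : DCube d → Matrix (Fin n) (Fin n) ℂ}
    (hW : MatMeasurable W) (hpos : ∀ᵐ x ∂(volume : Measure (Fin d → ℝ)), (W x).PosDef)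
    (hap : apNorm p W < ⊤) (hV : IsReducing p c₁ c₂ W V) {S : Set (DCube d)} {I : DCube d}
    (hS : ∀ J ∈ S, J.set ⊆ I.set) (hd : S.PairwiseDisjoint DCube.set) :
    ∑' J : S, ENNReal.ofReal (J : DCube d).vol *
        ENNReal.ofReal (matNorm ((V J)⁻¹ * V I)) ^ (p / (p - 1)) ≤
      (n : ℝ≥0∞) ^ (p / (p - 1) - 1) * (ENNReal.ofReal c₁)⁻¹ ^ (p / (p - 1)) *
        (n * (ENNReal.ofReal c₂ ^ (p / (p - 1)) * apNorm p W ^ (1 / (p - 1)))) *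
          ENNReal.ofReal I.vol := by
  have hpq : p.HolderConjugate (p / (p - 1)) := Real.HolderConjugate.conjExponent hp
  set q := p / (p - 1) with hq
  have hq0 : 0 < q := hpq.symm.pos
  have hc : ENNReal.ofReal c₁ ≠ 0 := by simpa using hc₁
  have hposI : ∀ J : DCube d, ∀ᵐ x ∂J.avgMeasure, (W x).PosDef := fun J =>
    J.avgMeasure_absolutelyContinuous.ae_le hpos
  simp only [← enorm_toEuclideanCLM]
  refine tsum_vol_mul_enorm_rpow_le hpq.symm.lt.le hS hd
    (M := fun J => Matrix.toEuclideanCLM (𝕜 := ℂ) (n := Fin n) ((V J)⁻¹ * V I))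
    (φ := fun i x => ‖Matrix.toEuclideanCLM (𝕜 := ℂ) (n := Fin n) (W x)⁻¹
      (Matrix.toEuclideanCLM (𝕜 := ℂ) (n := Fin n) (V I) (EuclideanSpace.single i 1))‖ₑ ^ q)
    (fun J i => ?_) fun i => ?_
  · rw [map_mul, mul_apply_eq_comp]
    set e := Matrix.toEuclideanCLM (𝕜 := ℂ) (n := Fin n) (V I) (EuclideanSpace.single i 1)
    have h := enorm_reducing_inv_le (ν := J.avgMeasure) hpq
      hW.stronglyMeasurable_toEuclideanCLM.aestronglyMeasurable
      hW.inv.stronglyMeasurable_toEuclideanCLM.aestronglyMeasurable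
      ((hposI J).mono fun x hx v w => by rw [← hx.inner_toEuclideanCLM, hx.toEuclideanCLM_apply_inv])
      (hV J).1.inv.inner_toEuclideanCLM (hV J).1.toEuclideanCLM_apply_inv
      (fun v => by
        have h := ((hV J).2 v).1
        rwa [redAvgD_eq, mApp, ofReal_norm] at h) e
    have h2 : ‖Matrix.toEuclideanCLM (𝕜 := ℂ) (n := Fin n) (V J)⁻¹ e‖ₑ ≤
        (ENNReal.ofReal c₁)⁻¹ * (∫⁻ x, ‖Matrix.toEuclideanCLM (𝕜 := ℂ) (n := Fin n) (W x)⁻¹ e‖ₑ ^ q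
          ∂J.avgMeasure) ^ (1 / q) := by
      refine le_trans (le_of_eq ?_) (mul_le_mul_right h _)
      rw [← mul_assoc, ENNReal.inv_mul_cancel hc ENNReal.ofReal_ne_top, one_mul]
    refine (ENNReal.rpow_le_rpow h2 hq0.le).trans (le_of_eq ?_)
    rw [ENNReal.mul_rpow_of_nonneg _ _ hq0.le, ← ENNReal.rpow_mul, one_div_mul_cancel hq0.ne',
      ENNReal.rpow_one]
  · have h := lintegral_enorm_inv_apply_reducing_le (ν := I.avgMeasure) hpq
      (A := fun x => Matrix.toEuclideanCLM (𝕜 := ℂ) (n := Fin n) (W x))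
      hW.inv.stronglyMeasurable_toEuclideanCLM.aestronglyMeasurable
      ((hposI I).mono fun x hx => hx.inv.inner_toEuclideanCLM)
      (lintegral_enorm_inv_ne_top hp hpos hap I) (hV I).1.inner_toEuclideanCLM
      (fun v => by
        have h := ((hV I).2 v).2
        rwa [redAvgD_eq, mApp, ofReal_norm] at h) (EuclideanSpace.single i 1)
    refine h.trans ?_
    have h1 : ‖EuclideanSpace.single i (1 : ℂ)‖ₑ = 1 := by simp [← ofReal_norm]
    rw [h1, mul_one]
    have : 0 ≤ 1 / (p - 1) := by have := hpq.sub_one_pos; positivity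
    gcongr
    exact lintegral_avgMeasure_le_apNorm hp W I

theorem one_le_inv_reducing_bound {d n : ℕ} (hn : 0 < n) {p c₁ c₂ : ℝ} (hp : 1 < p) (hc₁ : 0 < c₁)
    {W : (Fin d → ℝ) → Matrix (Fin n) (Fin n) ℂ} {V : DCube d → Matrix (Fin n) (Fin n) ℂ}
    (hW : MatMeasurable W) (hpos : ∀ᵐ x ∂(volume : Measure (Fin d → ℝ)), (W x).PosDef)
    (hap : apNorm p W < ⊤) (hV : IsReducing p c₁ c₂ W V) :
    1 ≤ (n : ℝ≥0∞) ^ (p / (p - 1) - 1) * (ENNReal.ofReal c₁)⁻¹ ^ (p / (p - 1)) *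
        (n * (ENNReal.ofReal c₂ ^ (p / (p - 1)) * apNorm p W ^ (1 / (p - 1)))) := by
  let I : DCube d := ⟨0, 0⟩
  have h := tsum_vol_mul_inv_reducing_rpow_le hp hc₁ hW hpos hap hV (S := {I}) (I := I)
    (by simp) (Set.pairwiseDisjoint_singleton _ _)
  have h1 : matNorm ((V I)⁻¹ * V I) = 1 := by
    have : Nonempty (Fin n) := ⟨⟨0, hn⟩⟩
    rw [matNorm, Matrix.nonsing_inv_mul _ ((Matrix.isUnit_iff_isUnit_det _).1 (hV I).1.isUnit),
      map_one, norm_one]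
  have hs : ∀ f : DCube d → ℝ≥0∞, ∑' J : ({I} : Set (DCube d)), f J = f I := fun f => by
    rw [tsum_singleton I f]
  rw [hs (fun J => ENNReal.ofReal J.vol * ENNReal.ofReal (matNorm ((V J)⁻¹ * V I)) ^ _), h1] at h
  have hv : I.vol = 1 := by simp [I, DCube.vol]
  simpa [hv] using h

/-- the decay lemma.  Let `1 < p < ∞` and let `W` be a matrix `A_p`
weight on `ℝ^d` with reducing operators `V_I`.  There exist `λ₁ > 1` depending only on
`n, d, p` (and the comparability constants `c₁, c₂`) and `λ₂ > 1` with
`λ₂ ≤ C ‖W‖_{A_p}^{p'/p}` such that the stopping time `𝒥(I)` consisting of the maximal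
dyadic subcubes `J ⊆ I` with `‖V_J V_I^{-1}‖^p > λ₁` or `‖V_J^{-1} V_I‖^{p'} > λ₂`
satisfies `∑_{J ∈ 𝒥^j(I)} |J| ≤ 2^{-j} |I|` for every `I ∈ 𝒟` and `j ∈ ℕ`. -/
theorem statement5 (d n : ℕ) (hd : 0 < d) (hn : 0 < n) (p c₁ c₂ : ℝ)
    (hp : 1 < p) (hc₁ : 0 < c₁) (hc₂ : 0 < c₂) :
    ∃ l₁ C : ℝ, 1 < l₁ ∧ 0 < C ∧
      ∀ (W1p : (Fin d → ℝ) → Matrix (Fin n) (Fin n) ℂ)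
        (V : DCube d → Matrix (Fin n) (Fin n) ℂ),
        MatMeasurable W1p →
        (∀ᵐ x ∂(volume : Measure (Fin d → ℝ)), (W1p x).PosDef) →
        apNorm p W1p < ⊤ →
        IsReducing p c₁ c₂ W1p V →
        ∃ l₂ : ℝ, 1 < l₂ ∧ l₂ ≤ C * (apNorm p W1p).toReal ^ (1 / (p - 1)) ∧
          ∀ (I : DCube d) (j : ℕ),
            ∑' J : JIter (stopST p l₁ l₂ V) j I, ENNReal.ofReal (J : DCube d).vol ≤
              (2 : ℝ≥0∞)⁻¹ ^ j * ENNReal.ofReal I.vol := by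
  have hq0 : 0 < p / (p - 1) := div_pos (by linarith) (by linarith)
  have hq1 : 0 ≤ p / (p - 1) - 1 := by
    rw [sub_nonneg, le_div_iff₀ (by linarith)]; linarith
  have hp0 : 0 < p := by linarith
  have hc : ENNReal.ofReal c₁ ≠ 0 := by simpa using hc₁
  have hcinv : (ENNReal.ofReal c₁)⁻¹ ≠ ∞ := ENNReal.inv_ne_top.2 hc
  set K₁ : ℝ≥0∞ := (n : ℝ≥0∞) ^ (p - 1) * ENNReal.ofReal c₂ ^ p *
    (n * (ENNReal.ofReal c₁)⁻¹ ^ p) with hK₁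
  set K₂ : ℝ≥0∞ := (n : ℝ≥0∞) ^ (p / (p - 1) - 1) * (ENNReal.ofReal c₁)⁻¹ ^ (p / (p - 1)) *
    (n * ENNReal.ofReal c₂ ^ (p / (p - 1))) with hK₂
  have hK₁top : K₁ ≠ ∞ := ENNReal.mul_ne_top (ENNReal.mul_ne_top
    (ENNReal.rpow_ne_top_of_nonneg (by linarith) (ENNReal.natCast_ne_top n))
    (ENNReal.rpow_ne_top_of_nonneg hp0.le ENNReal.ofReal_ne_top))
    (ENNReal.mul_ne_top (ENNReal.natCast_ne_top n) (ENNReal.rpow_ne_top_of_nonneg hp0.le hcinv))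
  have hK₂top : K₂ ≠ ∞ := ENNReal.mul_ne_top (ENNReal.mul_ne_top
    (ENNReal.rpow_ne_top_of_nonneg hq1 (ENNReal.natCast_ne_top n))
    (ENNReal.rpow_ne_top_of_nonneg hq0.le hcinv))
    (ENNReal.mul_ne_top (ENNReal.natCast_ne_top n)
      (ENNReal.rpow_ne_top_of_nonneg hq0.le ENNReal.ofReal_ne_top))
  refine ⟨4 * K₁.toReal + 2, 4 * K₂.toReal + 1, ?_, by positivity, ?_⟩
  · have : 0 ≤ K₁.toReal := ENNReal.toReal_nonneg
    linarith
  intro W V hW hpos hap hV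
  set N := apNorm p W ^ (1 / (p - 1)) with hN
  have hNtop : N ≠ ∞ := ENNReal.rpow_ne_top_of_nonneg
    (one_div_nonneg.2 (by linarith)) hap.ne
  have hKN : (n : ℝ≥0∞) ^ (p / (p - 1) - 1) * (ENNReal.ofReal c₁)⁻¹ ^ (p / (p - 1)) *
      (n * (ENNReal.ofReal c₂ ^ (p / (p - 1)) * N)) = K₂ * N := by rw [hK₂]; ring
  have hone : 1 ≤ K₂ * N := hKN ▸ one_le_inv_reducing_bound hn hp hc₁ hW hpos hap hV
  have hone' : 1 ≤ K₂.toReal * N.toReal := by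
    rw [← ENNReal.toReal_mul, ← ENNReal.toReal_one]
    exact ENNReal.toReal_mono (ENNReal.mul_ne_top hK₂top hNtop) hone
  refine ⟨4 * (K₂.toReal * N.toReal), by linarith, ?_, ?_⟩
  · rw [ENNReal.toReal_rpow, ← hN]
    have : 0 ≤ N.toReal := ENNReal.toReal_nonneg
    linarith
  refine tsum_JIter_le fun I => ?_
  set l₁ : ℝ := 4 * K₁.toReal + 2
  set l₂ : ℝ := 4 * (K₂.toReal * N.toReal)
  have hl₁ : 4 * K₁ ≤ ENNReal.ofReal l₁ := by
    rw [← ENNReal.ofReal_toReal hK₁top, show (4 : ℝ≥0∞) = ENNReal.ofReal 4 by simp,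
      ← ENNReal.ofReal_mul (by norm_num)]
    exact ENNReal.ofReal_le_ofReal (by linarith)
  have hl₂ : 4 * (K₂ * N) ≤ ENNReal.ofReal l₂ := by
    rw [← ENNReal.ofReal_toReal (ENNReal.mul_ne_top hK₂top hNtop),
      show (4 : ℝ≥0∞) = ENNReal.ofReal 4 by simp, ← ENNReal.ofReal_mul (by norm_num),
      ENNReal.toReal_mul]
  have hl₁pos : 0 < l₁ := by positivity
  have hl₂pos : 0 < l₂ := by linarith
  set S := stopST p l₁ l₂ V I with hS
  have hsub : ∀ J ∈ S, J.set ⊆ I.set := fun J hJ => hJ.1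
  have hdis : S.PairwiseDisjoint DCube.set := stopST_pairwiseDisjoint p l₁ l₂ V I
  set S₁ := {J ∈ S | l₁ < matNorm (V J * (V I)⁻¹) ^ p}
  set S₂ := {J ∈ S | l₂ < matNorm ((V J)⁻¹ * V I) ^ (p / (p - 1))}
  have hS₁ : S₁ ⊆ S := Set.sep_subset _ _
  have hS₂ : S₂ ⊆ S := Set.sep_subset _ _
  have hunion : S = S₁ ∪ S₂ := by
    ext J
    refine ⟨fun hJ => ?_, fun hJ => hJ.elim (fun h => hS₁ h) fun h => hS₂ h⟩
    exact hJ.2.1.imp (fun h => ⟨hJ, h⟩) fun h => ⟨hJ, h⟩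
  have hmat : ∀ M : Matrix (Fin n) (Fin n) ℂ, 0 ≤ matNorm M := fun M => norm_nonneg _
  have h₁ : ∑' J : S₁, ENNReal.ofReal (J : DCube d).vol ≤ 4⁻¹ * ENNReal.ofReal I.vol := by
    refine tsum_vol_le_of_le (G := fun J => ENNReal.ofReal (matNorm (V J * (V I)⁻¹)) ^ p)
      (by simpa using hl₁pos) ENNReal.ofReal_ne_top (fun J hJ => ?_)
      (tsum_vol_mul_reducing_rpow_le hp hc₁ hV (fun J hJ => hsub J (hS₁ hJ)) (hdis.subset hS₁)) hl₁
    rw [ENNReal.ofReal_rpow_of_nonneg (hmat _) hp0.le]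
    exact ENNReal.ofReal_le_ofReal hJ.2.le
  have h₂ : ∑' J : S₂, ENNReal.ofReal (J : DCube d).vol ≤ 4⁻¹ * ENNReal.ofReal I.vol := by
    refine tsum_vol_le_of_le
      (G := fun J => ENNReal.ofReal (matNorm ((V J)⁻¹ * V I)) ^ (p / (p - 1)))
      (by simpa using hl₂pos) ENNReal.ofReal_ne_top (fun J hJ => ?_)
      (tsum_vol_mul_inv_reducing_rpow_le hp hc₁ hW hpos hap hV (fun J hJ => hsub J (hS₂ hJ))
        (hdis.subset hS₂)) (hKN ▸ hl₂)
    rw [ENNReal.ofReal_rpow_of_nonneg (hmat _) hq0.le]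
    exact ENNReal.ofReal_le_ofReal hJ.2.le
  rw [hunion]
  refine (ENNReal.tsum_union_le (fun J : DCube d => ENNReal.ofReal J.vol) S₁ S₂).trans
    ((add_le_add h₁ h₂).trans (le_of_eq ?_))
  rw [← add_mul, ← two_mul, show (4 : ℝ≥0∞) = 2 * 2 by norm_num,
    ENNReal.mul_inv (by simp) (by simp), ← mul_assoc,
    ENNReal.mul_inv_cancel (by norm_num) (by norm_num), one_mul]

end
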